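/- arXiv:1706.09233 — 2 statements merged into one kernel-verified Lean document; each statement's English description precedes it below -/
import Mathlib

section
/- Let f : [0,∞) → (0,∞) be completely monotonic and injective, with inverse f⁻¹ defined on its range. Let f₁ : [0,∞) → ℝ be a continuous function taking values in the range of f such that g := f⁻¹ ∘ f₁ is a Bernstein function. Let C_T : ℝ → ℝ be a continuous even function taking values in the range of f such that for every ξ > 0 the function u ↦ exp(−ξ·f⁻¹(C_T(u))) is positive definite on ℝ. Then for every integer n ≥ 1, the quasi-arithmetic kernel ((s₁,t₁),(s₂,t₂)) ↦ f((1/2)·f⁻¹(f₁(d_GC(s₁,s₂))) + (1/2)·f⁻¹(C_T(t₁ − t₂))) is positive definite on 𝕊ⁿ × ℝ. -/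
open scoped RealInnerProductSpace

noncomputable def gcDist {n : ℕ} (x y : EuclideanSpace ℝ (Fin n)) : ℝ :=
  Real.arccos ⟪x, y⟫

def IsPosDefKernel {X : Type*} (K : X → X → ℝ) : Prop :=
  ∀ (N : ℕ) (x : Fin N → X) (c : Fin N → ℝ),
    0 ≤ ∑ i : Fin N, ∑ j : Fin N, c i * c j * K (x i) (x j)

/-- `f : ℝ → ℝ` is completely monotonic on `[0,∞)`: continuous on `[0,∞)`, infinitely
differentiable on `(0,∞)`, with `(-1)^j f^{(j)}(t) ≥ 0` for all `t > 0` and all `j`. -/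
def CompletelyMonotonicOn (f : ℝ → ℝ) : Prop :=
  ContinuousOn f (Set.Ici 0) ∧ ContDiffOn ℝ (⊤ : ℕ∞) f (Set.Ioi 0) ∧
    ∀ (j : ℕ) (t : ℝ), 0 < t → 0 ≤ (-1 : ℝ) ^ j * iteratedDerivWithin j f (Set.Ioi 0) t

/-- `g : ℝ → ℝ` is a Bernstein function on `[0,∞)`: continuous and nonnegative on `[0,∞)`,
infinitely differentiable on `(0,∞)`, with completely monotonic first derivative, i.e.
`(-1)^j g^{(j+1)}(t) ≥ 0` for all `t > 0` and all `j`. -/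
def BernsteinFn (g : ℝ → ℝ) : Prop :=
  ContinuousOn g (Set.Ici 0) ∧ (∀ t : ℝ, 0 ≤ t → 0 ≤ g t) ∧
    ContDiffOn ℝ (⊤ : ℕ∞) g (Set.Ioi 0) ∧
    ∀ (j : ℕ) (t : ℝ), 0 < t → 0 ≤ (-1 : ℝ) ^ j * iteratedDerivWithin (j + 1) g (Set.Ioi 0) t

open Filter Topology

/-- Positive semidefinite (symmetric) finite kernels. -/
def PSDK {N : ℕ} (K : Fin N → Fin N → ℝ) : Prop := (Matrix.of K).PosSemidef

lemma psdk_iff {N : ℕ} (K : Fin N → Fin N → ℝ) :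
    PSDK K ↔ (∀ i j, K i j = K j i) ∧
      ∀ c : Fin N → ℝ, 0 ≤ ∑ i, ∑ j, c i * c j * K i j := by
  unfold PSDK
  rw [Matrix.posSemidef_iff_dotProduct_mulVec]
  refine and_congr ?_ ?_
  · constructor
    · intro h i j
      have := h.apply j i
      simpa using this
    · intro h
      ext i j
      simp [h j i]
  · refine forall_congr' fun c => ?_
    have : star c ⬝ᵥ (Matrix.of K).mulVec c = ∑ i, ∑ j, c i * c j * K i j := by
      simp only [dotProduct, Matrix.mulVec, Finset.mul_sum, Matrix.of_apply, Pi.star_apply,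
        star_trivial]
      refine Finset.sum_congr rfl fun i _ => Finset.sum_congr rfl fun j _ => by ring
    rw [this]

lemma PSDK.mul {N : ℕ} {K L : Fin N → Fin N → ℝ} (hK : PSDK K) (hL : PSDK L) :
    PSDK (fun i j => K i j * L i j) :=
  Matrix.PosSemidef.hadamard hK hL

lemma PSDK.tendsto {N : ℕ} {α : Type*} {l : Filter α} [l.NeBot]
    {F : α → Fin N → Fin N → ℝ} {K : Fin N → Fin N → ℝ}
    (hF : ∀ᶠ a in l, PSDK (F a)) (h : ∀ i j, Tendsto (fun a => F a i j) l (𝓝 (K i j))) :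
    PSDK K := by
  rw [psdk_iff]
  constructor
  · intro i j
    refine tendsto_nhds_unique (h i j) ((h j i).congr' ?_)
    filter_upwards [hF] with a ha
    exact ((psdk_iff _).1 ha).1 j i
  · intro c
    have : Tendsto (fun a => ∑ i, ∑ j, c i * c j * F a i j) l
        (𝓝 (∑ i, ∑ j, c i * c j * K i j)) :=
      tendsto_finsetSum _ fun i _ => tendsto_finsetSum _ fun j _ => (h i j).const_mul _
    refine ge_of_tendsto this ?_
    filter_upwards [hF] with a ha
    exact ((psdk_iff _).1 ha).2 c

lemma PSDK.smul {N : ℕ} {K : Fin N → Fin N → ℝ} (hK : PSDK K) {r : ℝ} (hr : 0 ≤ r) :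
    PSDK (fun i j => r * K i j) := by
  rw [psdk_iff] at hK ⊢
  refine ⟨fun i j => by rw [hK.1], fun c => ?_⟩
  have := mul_nonneg hr (hK.2 c)
  simp only [Finset.mul_sum] at this
  refine this.trans_eq ?_
  refine Finset.sum_congr rfl fun i _ => Finset.sum_congr rfl fun j _ => by ring

lemma PSDK.one {N : ℕ} : PSDK (fun _ _ : Fin N => (1 : ℝ)) := by
  rw [psdk_iff]
  refine ⟨fun i j => rfl, fun c => ?_⟩
  have : ∑ i, ∑ j, c i * c j * 1 = (∑ i, c i) * ∑ j, c j := by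
    rw [Finset.sum_mul_sum]; simp
  rw [this]
  exact mul_self_nonneg _

lemma PSDK.pow {N : ℕ} {K : Fin N → Fin N → ℝ} (hK : PSDK K) (m : ℕ) :
    PSDK (fun i j => K i j ^ m) := by
  induction m with
  | zero => simpa using PSDK.one
  | succ m ih => simpa only [pow_succ] using ih.mul hK

lemma PSDK.sum {N : ℕ} {ι : Type*} (s : Finset ι) {F : ι → Fin N → Fin N → ℝ}
    (hF : ∀ a ∈ s, PSDK (F a)) : PSDK (fun i j => ∑ a ∈ s, F a i j) := by
  rw [psdk_iff]
  constructor
  · intro i j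
    exact Finset.sum_congr rfl fun a ha => ((psdk_iff _).1 (hF a ha)).1 i j
  · intro c
    have : ∑ i, ∑ j, c i * c j * ∑ a ∈ s, F a i j
        = ∑ a ∈ s, ∑ i, ∑ j, c i * c j * F a i j := by
      simp only [Finset.mul_sum]
      rw [Finset.sum_comm (s := s)]
      refine Finset.sum_congr rfl fun i _ => ?_
      rw [Finset.sum_comm]
    rw [this]
    exact Finset.sum_nonneg fun a ha => ((psdk_iff _).1 (hF a ha)).2 c

lemma PSDK.hasSum {N : ℕ} {F : ℕ → Fin N → Fin N → ℝ} {K : Fin N → Fin N → ℝ}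
    (hF : ∀ a, PSDK (F a)) (h : ∀ i j, HasSum (fun a => F a i j) (K i j)) : PSDK K :=
  PSDK.tendsto (l := atTop) (F := fun n i j => ∑ a ∈ Finset.range n, F a i j)
    (Eventually.of_forall fun n => PSDK.sum _ fun a _ => hF a)
    (fun i j => (h i j).tendsto_sum_nat)

lemma PSDK.exp {N : ℕ} {K : Fin N → Fin N → ℝ} (hK : PSDK K) :
    PSDK (fun i j => Real.exp (K i j)) := by
  refine PSDK.hasSum (F := fun n i j => ((n.factorial : ℝ))⁻¹ * K i j ^ n)
    (fun n => (hK.pow n).smul (by positivity)) fun i j => ?_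
  have := NormedSpace.expSeries_div_hasSum_exp (𝔸 := ℝ) (K i j)
  rw [← Real.exp_eq_exp_ℝ] at this
  simpa [div_eq_inv_mul] using this

lemma PSDK.inv_sqrt {N : ℕ} {K : Fin N → Fin N → ℝ} (hK : PSDK K)
    (h1 : ∀ i j, |K i j| < 1) : PSDK (fun i j => 1 / √(1 - K i j)) := by
  have hL : PSDK (fun i j => - Real.log (1 - K i j)) := by
    refine PSDK.hasSum (F := fun n i j => ((n : ℝ) + 1)⁻¹ * K i j ^ (n + 1))
      (fun n => (hK.pow _).smul (by positivity)) fun i j => ?_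
    simpa [div_eq_inv_mul] using Real.hasSum_pow_div_log_of_abs_lt_one (h1 i j)
  have := (hL.smul (r := 1 / 2) (by norm_num)).exp
  convert this using 3 with i j
  have hp : 0 < 1 - K i j := by linarith [(abs_lt.1 (h1 i j)).2]
  rw [Real.sqrt_eq_rpow, Real.rpow_def_of_pos hp, one_div, ← Real.exp_neg]
  congr 1
  ring

lemma PSDK.arcsin {N : ℕ} {K : Fin N → Fin N → ℝ} (hK : PSDK K)
    (h1 : ∀ i j, |K i j| ≤ 1) : PSDK (fun i j => Real.arcsin (K i j)) := by
  have hs := (psdk_iff _).1 hK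
  rw [psdk_iff]
  refine ⟨fun i j => by rw [hs.1], fun c => ?_⟩
  set φ : ℝ → ℝ := fun s => ∑ i, ∑ j, c i * c j * Real.arcsin (s * K i j) with hφ
  have hlt : ∀ s ∈ Set.Ioo (0 : ℝ) 1, ∀ i j, |s * K i j| < 1 := by
    intro s hs i j
    rw [abs_mul, abs_of_pos hs.1]
    calc s * |K i j| ≤ s * 1 := mul_le_mul_of_nonneg_left (h1 i j) hs.1.le
      _ < 1 := by linarith [hs.2]
  have hd : ∀ s ∈ Set.Ioo (0 : ℝ) 1, HasDerivAt φ
      (∑ i, ∑ j, c i * c j * (1 / √(1 - (s * K i j) ^ 2) * K i j)) s := by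
    intro s hs
    refine HasDerivAt.fun_sum fun i _ => HasDerivAt.fun_sum fun j _ => ?_
    refine HasDerivAt.const_mul _ ?_
    have hb := abs_lt.1 (hlt s hs i j)
    have h2 : HasDerivAt (fun s : ℝ => s * K i j) (K i j) s := by
      simpa using (hasDerivAt_id s).mul_const (K i j)
    exact (Real.hasDerivAt_arcsin hb.1.ne' hb.2.ne).comp s h2
  have hmono : MonotoneOn φ (Set.Icc 0 1) := by
    refine monotoneOn_of_deriv_nonneg (convex_Icc 0 1) ?_ ?_ ?_
    · refine Continuous.continuousOn ?_
      have := Real.continuous_arcsin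
      fun_prop
    · rw [interior_Icc]
      exact fun s hs => (hd s hs).differentiableAt.differentiableWithinAt
    · rw [interior_Icc]
      intro s hs
      rw [(hd s hs).deriv]
      have hw : PSDK (fun i j => (s * K i j) ^ 2) := (hK.smul hs.1.le).pow 2
      have h3 := (hw.inv_sqrt (fun i j => by
        rw [abs_pow]
        exact pow_lt_one₀ (abs_nonneg _) (hlt s hs i j) two_ne_zero)).mul hK
      exact ((psdk_iff _).1 h3).2 c
  have := hmono (Set.left_mem_Icc.2 zero_le_one) (Set.right_mem_Icc.2 zero_le_one) zero_le_one
  simpa [hφ] using this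

lemma psdk_exp_gcDist {N n : ℕ} (s : Fin N → Metric.sphere (0 : EuclideanSpace ℝ (Fin n)) 1)
    (ξ : ℝ) (hξ : 0 < ξ) :
    PSDK (fun i j => Real.exp (-ξ * gcDist (s i : EuclideanSpace ℝ (Fin n)) (s j))) := by
  have hG : PSDK (fun i j => ⟪(s i : EuclideanSpace ℝ (Fin n)), (s j)⟫) :=
    Matrix.posSemidef_gram ℝ (fun i => (s i : EuclideanSpace ℝ (Fin n)))
  have h1 : ∀ i j, |⟪(s i : EuclideanSpace ℝ (Fin n)), (s j)⟫| ≤ 1 := by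
    intro i j
    have := abs_real_inner_le_norm (s i : EuclideanSpace ℝ (Fin n)) (s j)
    have hn : ∀ i, ‖(s i : EuclideanSpace ℝ (Fin n))‖ = 1 := fun i => by simp
    simpa [hn] using this
  have := (((hG.arcsin h1).smul hξ.le).exp).smul (Real.exp_pos (-ξ * (Real.pi / 2))).le
  convert this using 3 with i j
  rw [← Real.exp_add, gcDist, Real.arccos]
  congr 1
  ring

lemma CM.nonneg {f : ℝ → ℝ} (hf : CompletelyMonotonicOn f) {x : ℝ} (hx : 0 ≤ x) : 0 ≤ f x := by
  obtain ⟨hc, hd, hs⟩ := hf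
  have hpos : ∀ t : ℝ, 0 < t → 0 ≤ f t := fun t ht => by simpa using hs 0 t ht
  have hmem : x ∈ closure (Set.Ioi (0 : ℝ)) := by rw [closure_Ioi]; exact hx
  have : (𝓝[Set.Ioi 0] x).NeBot := mem_closure_iff_nhdsWithin_neBot.1 hmem
  have ht : Tendsto f (𝓝[Set.Ioi 0] x) (𝓝 (f x)) :=
    (hc x hx).mono_left (nhdsWithin_mono _ Set.Ioi_subset_Ici_self)
  refine ge_of_tendsto ht ?_
  filter_upwards [self_mem_nhdsWithin] with t h using hpos t h

lemma CM.antitone_deriv {f : ℝ → ℝ} (hf : CompletelyMonotonicOn f) (j : ℕ) :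
    AntitoneOn (fun t => (-1 : ℝ) ^ j * iteratedDerivWithin j f (Set.Ioi 0) t) (Set.Ioi 0) := by
  obtain ⟨hc, hd, hs⟩ := hf
  have hdiff : DifferentiableOn ℝ (iteratedDerivWithin j f (Set.Ioi 0)) (Set.Ioi 0) :=
    hd.differentiableOn_iteratedDerivWithin (by exact_mod_cast WithTop.coe_lt_top _)
      (isOpen_Ioi.uniqueDiffOn)
  refine antitoneOn_of_deriv_nonpos (convex_Ioi 0) (hdiff.const_mul _).continuousOn ?_ ?_
  · rw [interior_Ioi]; exact hdiff.const_mul _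
  · rw [interior_Ioi]
    intro t ht
    have h1 := hs (j + 1) t ht
    have hda : DifferentiableAt ℝ (iteratedDerivWithin j f (Set.Ioi 0)) t :=
      (hdiff t ht).differentiableAt (isOpen_Ioi.mem_nhds ht)
    rw [iteratedDerivWithin_succ, derivWithin_of_isOpen isOpen_Ioi ht, pow_succ] at h1
    rw [deriv_const_mul _ hda]
    linarith

lemma CM.diff {f : ℝ → ℝ} (hf : CompletelyMonotonicOn f) {δ : ℝ} (hδ : 0 < δ) :
    CompletelyMonotonicOn (fun x => f x - f (x + δ)) := by
  have hanti := CM.antitone_deriv hf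
  obtain ⟨hc, hd, hs⟩ := hf
  have hsh : ContDiffOn ℝ (⊤ : ℕ∞) (fun x => f (x + δ)) (Set.Ioi 0) := by
    refine hd.comp (t := Set.Ioi 0) (g := f) (f := fun x => x + δ) (by fun_prop) ?_
    intro x hx
    simp only [Set.mem_Ioi] at *
    linarith
  refine ⟨?_, hd.sub hsh, ?_⟩
  · refine hc.sub (hc.comp (t := Set.Ici 0) (f := fun x => x + δ) (by fun_prop) ?_)
    intro x hx
    simp only [Set.mem_Ici] at *
    linarith
  · intro j t ht
    have h1 : iteratedDerivWithin j (fun x => f x - f (x + δ)) (Set.Ioi 0) t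
        = iteratedDerivWithin j f (Set.Ioi 0) t
          - iteratedDerivWithin j (fun x => f (x + δ)) (Set.Ioi 0) t :=
      iteratedDerivWithin_sub (f := f) (g := fun x => f (x + δ)) ht isOpen_Ioi.uniqueDiffOn
        ((hd t ht).of_le (by exact_mod_cast le_top)) ((hsh t ht).of_le (by exact_mod_cast le_top))
    have htd : t + δ ∈ Set.Ioi (0 : ℝ) := by
      simp only [Set.mem_Ioi] at *
      linarith
    have h2 : iteratedDerivWithin j (fun x => f (x + δ)) (Set.Ioi 0) t
        = iteratedDerivWithin j f (Set.Ioi 0) (t + δ) := by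
      rw [iteratedDerivWithin_comp_add_const]
      refine iteratedDerivWithin_congr_right_of_isOpen f j (isOpen_Ioi.vadd δ) isOpen_Ioi ⟨?_, htd⟩
      exact ⟨t, ht, by simp [add_comm]⟩
    rw [h1, h2, mul_sub]
    exact sub_nonneg.2 (hanti j ht htd (by linarith))

lemma BF.exp_cm {g : ℝ → ℝ} (hg : BernsteinFn g) {ξ : ℝ} (hξ : 0 < ξ) :
    CompletelyMonotonicOn (fun x => Real.exp (-ξ * g x)) := by
  obtain ⟨hc, -, hd, hs⟩ := hg
  have hu : UniqueDiffOn ℝ (Set.Ioi (0 : ℝ)) := isOpen_Ioi.uniqueDiffOn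
  set h : ℝ → ℝ := fun x => Real.exp (-ξ * g x) with hh
  have hhd : ContDiffOn ℝ (⊤ : ℕ∞) h (Set.Ioi 0) := (contDiffOn_const.mul hd).exp
  refine ⟨?_, hhd, ?_⟩
  · exact (continuousOn_const.mul hc).rexp
  have hg' : ContDiffOn ℝ (⊤ : ℕ∞) (derivWithin g (Set.Ioi 0)) (Set.Ioi 0) :=
    hd.derivWithin hu (by exact_mod_cast le_rfl)
  have hder : Set.EqOn (derivWithin h (Set.Ioi 0))
      (((fun _ => -ξ) * derivWithin g (Set.Ioi 0)) * h) (Set.Ioi 0) := by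
    intro x hx
    have hgx : HasDerivWithinAt g (derivWithin g (Set.Ioi 0) x) (Set.Ioi 0) x :=
      ((hd x hx).differentiableWithinAt (by simp)).hasDerivWithinAt
    have := ((hgx.const_mul (-ξ)).exp).derivWithin (hu x hx)
    simp only [Pi.mul_apply, hh]
    rw [this]
    ring
  intro j
  induction j using Nat.strong_induction_on with
  | _ j ih =>
    intro t ht
    rcases j with _ | n
    · simp [hh, Real.exp_nonneg]
    · rw [iteratedDerivWithin_succ', iteratedDerivWithin_congr hder ht,
        iteratedDerivWithin_mul (s := Set.Ioi 0) ht hu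
          (f := (fun _ => -ξ) * derivWithin g (Set.Ioi 0))
          (((contDiffOn_const.mul hg') t ht).of_le (by exact_mod_cast le_top))
          ((hhd t ht).of_le (by exact_mod_cast le_top)), Finset.mul_sum]
      refine Finset.sum_nonneg fun i hi => ?_
      have hin : i ≤ n := by simpa [Nat.lt_succ_iff] using hi
      have e1 : iteratedDerivWithin i ((fun _ => -ξ) * derivWithin g (Set.Ioi 0)) (Set.Ioi 0) t
          = -ξ * iteratedDerivWithin (i + 1) g (Set.Ioi 0) t := by
        rw [iteratedDerivWithin_succ']
        exact iteratedDerivWithin_const_mul_field (-ξ) _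
      rw [e1]
      have a1 := hs i t ht
      have a2 := ih (n - i) (by omega) t ht
      have e2 : (-1 : ℝ) ^ (n + 1) = -((-1) ^ i * (-1) ^ (n - i)) := by
        rw [← pow_add, Nat.add_sub_cancel' hin, pow_succ]; ring
      rw [e2]
      have := mul_nonneg (mul_nonneg (mul_nonneg hξ.le (Nat.cast_nonneg (α := ℝ) (n.choose i))) a1) a2
      linarith

open Polynomial in
/-- The moment functional of a sequence. -/
noncomputable def momL (a : ℕ → ℝ) : ℝ[X] →ₗ[ℝ] ℝ :=
  Polynomial.lsum (fun k => a k • LinearMap.id)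

open Polynomial in
lemma momL_X_pow (a : ℕ → ℝ) (k : ℕ) : momL a (X ^ k) = a k := by
  simp [momL, Polynomial.lsum_apply, ← Polynomial.monomial_one_right_eq_X_pow,
    Polynomial.sum_monomial_index]

/-- Difference operator. -/
def dOp (δ : ℝ) (f : ℝ → ℝ) : ℝ → ℝ := fun x => f x - f (x + δ)

open Polynomial in
lemma momL_eq_dOp (f : ℝ → ℝ) (δ : ℝ) (m k : ℕ) :
    momL (fun k => f (k * δ)) (X ^ k * (1 - X) ^ m) = ((dOp δ)^[m] f) (k * δ) := by
  induction m generalizing k with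
  | zero => simp [momL_X_pow]
  | succ m ih =>
    have e : (X ^ k * (1 - X) ^ (m + 1) : ℝ[X])
        = X ^ k * (1 - X) ^ m - X ^ (k + 1) * (1 - X) ^ m := by ring
    rw [e, map_sub, ih, ih, Function.iterate_succ_apply', dOp]
    push_cast
    rw [add_mul, one_mul]

lemma CM.iter {f : ℝ → ℝ} (hf : CompletelyMonotonicOn f) {δ : ℝ} (hδ : 0 < δ) (m : ℕ) :
    CompletelyMonotonicOn ((dOp δ)^[m] f) := by
  induction m with
  | zero => exact hf
  | succ m ih =>
    rw [Function.iterate_succ_apply']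
    exact CM.diff ih hδ

/-- Hausdorff weights. -/
noncomputable def hw (f : ℝ → ℝ) (δ : ℝ) (n k : ℕ) : ℝ :=
  n.choose k * ((dOp δ)^[n - k] f) (k * δ)

lemma hw_nonneg {f : ℝ → ℝ} (hf : CompletelyMonotonicOn f) {δ : ℝ} (hδ : 0 < δ) (n k : ℕ) :
    0 ≤ hw f δ n k :=
  mul_nonneg (Nat.cast_nonneg _) (CM.nonneg (CM.iter hf hδ _) (by positivity))

open Polynomial in
lemma hw_ident (f : ℝ → ℝ) (δ : ℝ) (m j : ℕ) :
    f (j * δ) = ∑ k ∈ Finset.range (m + j + 1),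
      hw f δ (m + j) k * ((k.descFactorial j : ℝ) / ((m + j).descFactorial j)) := by
  have h1 : f (j * δ) = ∑ i ∈ Finset.range (m + 1),
      (m.choose i : ℝ) * ((dOp δ)^[m - i] f) ((j + i : ℕ) * δ) := by
    have e : (X ^ j : ℝ[X]) = ∑ i ∈ Finset.range (m + 1),
        (m.choose i : ℝ) • (X ^ (j + i) * (1 - X) ^ (m - i)) := by
      have : (X ^ j : ℝ[X]) = X ^ j * (X + (1 - X)) ^ m := by simp
      rw [this, add_pow, Finset.mul_sum]
      refine Finset.sum_congr rfl fun i _ => ?_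
      rw [Nat.cast_smul_eq_nsmul, nsmul_eq_mul]
      ring
    have := congrArg (momL (fun k => f (k * δ))) e
    rw [momL_X_pow, map_sum] at this
    rw [this]
    refine Finset.sum_congr rfl fun i _ => ?_
    rw [map_smul, momL_eq_dOp, smul_eq_mul]
  rw [h1, show m + j + 1 = j + (m + 1) by ring, Finset.sum_range_add _ j (m + 1)]
  rw [Finset.sum_eq_zero (s := Finset.range j), zero_add]
  · refine Finset.sum_congr rfl fun i hi => ?_
    have him : i ≤ m := by simpa [Nat.lt_succ_iff] using hi
    unfold hw
    have hne : ((m + j).descFactorial j : ℝ) ≠ 0 := by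
      exact_mod_cast (Nat.descFactorial_pos.2 (by omega)).ne'
    have hch : ((m + j).choose (j + i) : ℝ) * ((j + i).descFactorial j)
        = (m.choose i) * ((m + j).descFactorial j) := by
      have := Nat.choose_mul (n := m + j) (k := j + i) (s := j) (by omega)
      rw [Nat.add_sub_cancel, Nat.add_sub_cancel_left] at this
      rw [Nat.descFactorial_eq_factorial_mul_choose, Nat.descFactorial_eq_factorial_mul_choose]
      push_cast
      have h3 : ((m + j).choose (j + i) : ℝ) * ((j + i).choose j)
        = ((m + j).choose j) * (m.choose i) := by exact_mod_cast this
      linear_combination (j.factorial : ℝ) * h3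
    rw [show m + j - (j + i) = m - i by omega]
    field_simp
    linear_combination (-((dOp δ)^[m - i] f) ((j + i : ℕ) * δ)) * hch
  · intro k hk
    rw [Nat.descFactorial_of_lt (by simpa using hk)]
    simp

lemma desc_bound (n k : ℕ) (hk : k ≤ n) (hn : 0 < n) (j : ℕ) (hj : j ≤ n) :
    0 ≤ (k.descFactorial j : ℝ) / (n.descFactorial j) ∧
    (k.descFactorial j : ℝ) / (n.descFactorial j) ≤ 1 ∧
    |((k : ℝ) / n) ^ j - (k.descFactorial j : ℝ) / (n.descFactorial j)| ≤ (j : ℝ) ^ 2 / n := by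
  have hn' : (0 : ℝ) < n := by exact_mod_cast hn
  have hk' : (k : ℝ) ≤ n := by exact_mod_cast hk
  induction j with
  | zero => simp
  | succ j ih =>
    obtain ⟨h0, h1, h2⟩ := ih (by omega)
    set y := (k.descFactorial j : ℝ) / (n.descFactorial j) with hy
    have hjn : (0 : ℝ) < (n : ℝ) - j := by
      have : ((j + 1 : ℕ) : ℝ) ≤ n := by exact_mod_cast hj
      push_cast at this; linarith
    have e : (k.descFactorial (j + 1) : ℝ) / (n.descFactorial (j + 1))
        = ((k - j : ℕ) : ℝ) / ((n : ℝ) - j) * y := by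
      rw [Nat.descFactorial_succ, Nat.descFactorial_succ, hy]
      push_cast [Nat.cast_sub (show j ≤ n by omega)]
      rw [mul_div_mul_comm]
    set z := ((k - j : ℕ) : ℝ) / ((n : ℝ) - j) with hz
    have hz0 : 0 ≤ z := by positivity
    have hkj : ((k - j : ℕ) : ℝ) ≤ (n : ℝ) - j := by
      rw [← Nat.cast_sub (show j ≤ n by omega)]
      exact_mod_cast Nat.sub_le_sub_right hk j
    have hz1 : z ≤ 1 := (div_le_one hjn).2 hkj
    have hx0 : 0 ≤ (k : ℝ) / n := by positivity
    have hx1 : (k : ℝ) / n ≤ 1 := (div_le_one hn').2 hk'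
    have hxz : |(k : ℝ) / n - z| ≤ j / n := by
      rcases le_total j k with h | h
      · have hjk : (j : ℝ) ≤ k := by exact_mod_cast h
        have e2 : (k : ℝ) / n - z = (j / n) * ((n - k) / (n - j)) := by
          rw [hz, Nat.cast_sub h]
          field_simp
          ring
        have h3 : 0 ≤ ((n : ℝ) - k) / (n - j) := div_nonneg (by linarith) hjn.le
        have h4 : ((n : ℝ) - k) / (n - j) ≤ 1 := (div_le_one hjn).2 (by linarith)
        have h5 : 0 ≤ (j : ℝ) / n := by positivity
        rw [e2, abs_of_nonneg (mul_nonneg h5 h3)]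
        exact mul_le_of_le_one_right h5 h4
      · have hz' : z = 0 := by rw [hz, Nat.sub_eq_zero_of_le h]; simp
        rw [hz', sub_zero, abs_of_nonneg hx0]
        gcongr
    rw [e]
    refine ⟨mul_nonneg hz0 h0, mul_le_one₀ hz1 h0 h1, ?_⟩
    have e3 : ((k : ℝ) / n) ^ (j + 1) - z * y
        = ((k : ℝ) / n) * (((k : ℝ) / n) ^ j - y) + ((k : ℝ) / n - z) * y := by ring
    rw [e3]
    refine (abs_add_le _ _).trans ?_
    rw [abs_mul, abs_mul, abs_of_nonneg hx0, abs_of_nonneg h0]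
    have h6 : (k : ℝ) / n * |((k : ℝ) / n) ^ j - y| ≤ (j : ℝ) ^ 2 / n :=
      (mul_le_of_le_one_left (abs_nonneg _) hx1).trans h2
    have h7 : |(k : ℝ) / n - z| * y ≤ j / n :=
      (mul_le_of_le_one_right (abs_nonneg _) h1).trans hxz
    refine (add_le_add h6 h7).trans ?_
    rw [← add_div]
    gcongr
    push_cast
    nlinarith [Nat.cast_nonneg (α := ℝ) j]

lemma hw_approx {f : ℝ → ℝ} (hf : CompletelyMonotonicOn f) {δ : ℝ} (hδ : 0 < δ) (n j : ℕ)
    (hn : 0 < n) (hj : j ≤ n) :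
    |∑ k ∈ Finset.range (n + 1), hw f δ n k * ((k : ℝ) / n) ^ j - f (j * δ)|
      ≤ f 0 * ((j : ℝ) ^ 2 / n) := by
  have hI : ∀ j ≤ n, f (j * δ) = ∑ k ∈ Finset.range (n + 1),
      hw f δ n k * ((k.descFactorial j : ℝ) / (n.descFactorial j)) := by
    intro j hj
    have := hw_ident f δ (n - j) j
    rwa [Nat.sub_add_cancel hj] at this
  have h0 : f 0 = ∑ k ∈ Finset.range (n + 1), hw f δ n k := by
    simpa using hI 0 (Nat.zero_le _)
  rw [hI j hj, ← Finset.sum_sub_distrib, h0, Finset.sum_mul]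
  refine (Finset.abs_sum_le_sum_abs _ _).trans (Finset.sum_le_sum fun k hk => ?_)
  rw [← mul_sub, abs_mul, abs_of_nonneg (hw_nonneg hf hδ n k)]
  exact mul_le_mul_of_nonneg_left
    (desc_bound n k (by simpa [Nat.lt_succ_iff] using hk) hn j hj).2.2 (hw_nonneg hf hδ n k)

/-- Approximants by positive combinations of exponentials. -/
noncomputable def appr (f : ℝ → ℝ) (m : ℕ) (T : ℝ) : ℝ :=
  ∑ k ∈ Finset.range (m ^ 3 + 1),
    hw f (1 / (m : ℝ)) (m ^ 3) k * ((k : ℝ) / (m ^ 3 : ℕ)) ^ (T * m)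

lemma appr_tendsto {f : ℝ → ℝ} (hf : CompletelyMonotonicOn f) {T : ℝ} (hT : 0 ≤ T) :
    Tendsto (fun m => appr f m T) atTop (𝓝 (f T)) := by
  have hcast : Tendsto (fun m : ℕ => (m : ℝ)) atTop atTop := tendsto_natCast_atTop_atTop
  have hfl : Tendsto (fun m : ℕ => (⌊T * m⌋₊ : ℝ) / m) atTop (𝓝 T) :=
    (tendsto_nat_floor_mul_div_atTop hT).comp hcast
  have hce : Tendsto (fun m : ℕ => (⌈T * m⌉₊ : ℝ) / m) atTop (𝓝 T) :=
    (tendsto_nat_ceil_mul_div_atTop hT).comp hcast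
  have hfc : ∀ u : ℕ → ℝ, (∀ m, 0 ≤ u m) → Tendsto u atTop (𝓝 T) →
      Tendsto (fun m => f (u m)) atTop (𝓝 (f T)) := by
    intro u hu hut
    exact (hf.1 T hT).tendsto.comp
      (tendsto_nhdsWithin_iff.2 ⟨hut, Eventually.of_forall fun m => hu m⟩)
  -- error term
  have herr : Tendsto (fun m : ℕ => f 0 * (((⌈T * m⌉₊ : ℝ)) ^ 2 / (m ^ 3 : ℕ))) atTop (𝓝 0) := by
    have h1 : Tendsto (fun m : ℕ => f 0 * (((⌈T * m⌉₊ : ℝ) / m) ^ 2 * (m : ℝ)⁻¹)) atTop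
        (𝓝 (f 0 * (T ^ 2 * 0))) :=
      ((hce.pow 2).mul (tendsto_inv_atTop_zero.comp hcast)).const_mul _
    rw [mul_zero, mul_zero] at h1
    refine h1.congr' ?_
    filter_upwards [eventually_gt_atTop 0] with m hm
    have : (m : ℝ) ≠ 0 := by exact_mod_cast hm.ne'
    push_cast
    field_simp
  have hlow := (hfc _ (fun m => by positivity) hce).sub herr
  have hup := (hfc _ (fun m => by positivity) hfl).add herr
  rw [sub_zero] at hlow
  rw [add_zero] at hup
  have hle : ∀ᶠ m : ℕ in atTop, ⌈T * m⌉₊ ≤ m ^ 3 := by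
    filter_upwards [eventually_ge_atTop (⌈T⌉₊ + 1)] with m hm
    rw [Nat.ceil_le]
    have h1 : T ≤ m := (Nat.le_ceil T).trans (by exact_mod_cast (by omega : ⌈T⌉₊ ≤ m))
    have h2 : (1 : ℝ) ≤ m := by exact_mod_cast (by omega : 1 ≤ m)
    push_cast
    calc T * m ≤ m * m := by gcongr
      _ ≤ m * m * m := le_mul_of_one_le_right (by positivity) h2
      _ = (m : ℝ) ^ 3 := by ring
  have hfc' : ∀ m : ℕ, ⌊T * m⌋₊ ≤ ⌈T * m⌉₊ := fun m => Nat.floor_le_ceil _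
  have hf0 : 0 ≤ f 0 := CM.nonneg hf le_rfl
  refine tendsto_of_tendsto_of_tendsto_of_le_of_le' hlow hup ?_ ?_
  · filter_upwards [hle, eventually_gt_atTop 0] with m hm hm0
    have hmR : (0 : ℝ) < m := by exact_mod_cast hm0
    have hδ : (0 : ℝ) < 1 / m := by positivity
    have h1 := (abs_le.1 (hw_approx hf hδ (m ^ 3) ⌈T * m⌉₊ (by positivity) hm)).1
    have h2 : ∑ k ∈ Finset.range (m ^ 3 + 1), hw f (1 / (m : ℝ)) (m ^ 3) k
        * ((k : ℝ) / (m ^ 3 : ℕ)) ^ ⌈T * m⌉₊ ≤ appr f m T := by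
      refine Finset.sum_le_sum fun k hk => mul_le_mul_of_nonneg_left ?_ (hw_nonneg hf hδ _ _)
      have hk1 : (k : ℝ) ≤ (m ^ 3 : ℕ) := by
        exact_mod_cast (by simpa [Nat.lt_succ_iff] using hk : k ≤ m ^ 3)
      rw [← Real.rpow_natCast]
      exact Real.rpow_le_rpow_of_exponent_ge_of_imp (by positivity)
        (div_le_one_of_le₀ hk1 (by positivity)) (Nat.le_ceil _) (fun _ h => by
          exact le_antisymm ((Nat.le_ceil (T * m)).trans_eq h) (by positivity))
    rw [mul_one_div] at h1
    linarith
  · filter_upwards [hle, eventually_gt_atTop 0] with m hm hm0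
    have hmR : (0 : ℝ) < m := by exact_mod_cast hm0
    have hδ : (0 : ℝ) < 1 / m := by positivity
    have h1 := (abs_le.1 (hw_approx hf hδ (m ^ 3) ⌊T * m⌋₊ (by positivity)
      ((hfc' m).trans hm))).2
    have h2 : appr f m T ≤ ∑ k ∈ Finset.range (m ^ 3 + 1), hw f (1 / (m : ℝ)) (m ^ 3) k
        * ((k : ℝ) / (m ^ 3 : ℕ)) ^ ⌊T * m⌋₊ := by
      refine Finset.sum_le_sum fun k hk => mul_le_mul_of_nonneg_left ?_ (hw_nonneg hf hδ _ _)
      have hk1 : (k : ℝ) ≤ (m ^ 3 : ℕ) := by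
        exact_mod_cast (by simpa [Nat.lt_succ_iff] using hk : k ≤ m ^ 3)
      rw [← Real.rpow_natCast]
      exact Real.rpow_le_rpow_of_exponent_ge_of_imp (by positivity)
        (div_le_one_of_le₀ hk1 (by positivity)) (Nat.floor_le (by positivity)) (fun _ h => by
          rw [h]; simp)
    have h3 : f 0 * (((⌊T * m⌋₊ : ℝ)) ^ 2 / (m ^ 3 : ℕ))
        ≤ f 0 * (((⌈T * m⌉₊ : ℝ)) ^ 2 / (m ^ 3 : ℕ)) := by
      have : (⌊T * m⌋₊ : ℝ) ≤ ⌈T * m⌉₊ := by exact_mod_cast hfc' m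
      gcongr
    rw [mul_one_div] at h1
    linarith

lemma psdk_rpow {N : ℕ} {ψ : Fin N → Fin N → ℝ} (h0 : ∀ i j, 0 ≤ ψ i j)
    (h : ∀ ξ : ℝ, 0 < ξ → PSDK (fun i j => Real.exp (-ξ * ψ i j)))
    {x : ℝ} (hx : x ∈ Set.Icc (0 : ℝ) 1) : PSDK (fun i j => x ^ ψ i j) := by
  rw [← closure_Ioo (zero_ne_one (α := ℝ))] at hx
  have : (𝓝[Set.Ioo 0 1] x).NeBot := mem_closure_iff_nhdsWithin_neBot.1 hx
  refine PSDK.tendsto (l := 𝓝[Set.Ioo 0 1] x) (F := fun y i j => y ^ ψ i j) ?_ ?_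
  · filter_upwards [self_mem_nhdsWithin] with y hy
    have := h (-Real.log y) (by simpa using Real.log_neg hy.1 hy.2)
    simpa [Real.rpow_def_of_pos hy.1] using this
  · intro i j
    exact (Real.continuousAt_rpow_const x _ (Or.inr (h0 i j))).tendsto.mono_left
      nhdsWithin_le_nhds

lemma psdk_cm {N : ℕ} {ψ : Fin N → Fin N → ℝ} (h0 : ∀ i j, 0 ≤ ψ i j)
    (h : ∀ ξ : ℝ, 0 < ξ → PSDK (fun i j => Real.exp (-ξ * ψ i j)))
    {f : ℝ → ℝ} (hf : CompletelyMonotonicOn f) : PSDK (fun i j => f (ψ i j)) := by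
  refine PSDK.tendsto (l := atTop) (F := fun m i j => appr f m (ψ i j)) ?_
    (fun i j => appr_tendsto hf (h0 i j))
  filter_upwards [eventually_gt_atTop 0] with m hm
  have hmR : (0 : ℝ) < m := by exact_mod_cast hm
  refine PSDK.sum _ fun k hk => PSDK.smul ?_ (hw_nonneg hf (by positivity) _ _)
  have hk1 : (k : ℝ) ≤ (m ^ 3 : ℕ) := by
    exact_mod_cast (by simpa [Nat.lt_succ_iff] using hk : k ≤ m ^ 3)
  refine psdk_rpow (ψ := fun i j => ψ i j * m) (fun i j => mul_nonneg (h0 i j) hmR.le) ?_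
    ⟨by positivity, div_le_one_of_le₀ hk1 (by positivity)⟩
  intro ξ hξ
  have := h (ξ * m) (by positivity)
  convert this using 4
  ring

/-- The quasi-arithmetic construction
`ψ(d,u) = f((1/2) f⁻¹(f₁(d)) + (1/2) f⁻¹(C_T(u)))` is a geodesically isotropic,
temporally symmetric covariance function on `𝕊ⁿ × ℝ` for every `n ≥ 1`. -/
theorem quasi_arithmetic_posdef
    (f finv f₁ CT : ℝ → ℝ)
    (hf : CompletelyMonotonicOn f) (hfpos : ∀ t : ℝ, 0 ≤ t → 0 < f t)
    (hinj : Set.InjOn f (Set.Ici 0))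
    (hfinv : ∀ t : ℝ, 0 ≤ t → finv (f t) = t)
    (hf₁cont : Continuous f₁)
    (hf₁range : ∀ x : ℝ, 0 ≤ x → f₁ x ∈ f '' Set.Ici 0)
    (hBern : BernsteinFn (finv ∘ f₁))
    (hCTcont : Continuous CT) (hCTeven : ∀ u : ℝ, CT (-u) = CT u)
    (hCTrange : ∀ u : ℝ, CT u ∈ f '' Set.Ici 0)
    (hCTpd : ∀ ξ : ℝ, 0 < ξ →
      IsPosDefKernel (fun u₁ u₂ : ℝ => Real.exp (-ξ * finv (CT (u₁ - u₂)))))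
    (n : ℕ) (hn : 1 ≤ n) :
    IsPosDefKernel (fun p q : Metric.sphere (0 : EuclideanSpace ℝ (Fin (n + 1))) 1 × ℝ =>
      f ((1 / 2) * finv (f₁ (gcDist (p.1 : EuclideanSpace ℝ (Fin (n + 1)))
            (q.1 : EuclideanSpace ℝ (Fin (n + 1)))))
        + (1 / 2) * finv (CT (p.2 - q.2)))) := by
  intro N x c
  have hg0 : ∀ i j, 0 ≤ gcDist ((x i).1 : EuclideanSpace ℝ (Fin (n + 1))) (x j).1 :=
    fun i j => Real.arccos_nonneg _
  have hh0 : ∀ u, 0 ≤ finv (CT u) := by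
    intro u
    obtain ⟨t, ht, e⟩ := hCTrange u
    rw [← e, hfinv t ht]
    exact ht
  refine ((psdk_iff _).1 (psdk_cm (ψ := fun i j =>
    (1 / 2) * finv (f₁ (gcDist ((x i).1 : EuclideanSpace ℝ (Fin (n + 1))) (x j).1))
      + (1 / 2) * finv (CT ((x i).2 - (x j).2))) ?_ ?_ hf)).2 c
  · intro i j
    have h1 := hBern.2.1 _ (hg0 i j)
    have h2 := hh0 ((x i).2 - (x j).2)
    simp only [Function.comp] at h1
    positivity
  · intro ξ hξ
    have hξ2 : 0 < ξ / 2 := by positivity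
    have hA : PSDK (fun i j => Real.exp (-(ξ / 2) *
        (finv ∘ f₁) (gcDist ((x i).1 : EuclideanSpace ℝ (Fin (n + 1))) (x j).1))) :=
      psdk_cm hg0 (fun η hη => psdk_exp_gcDist (fun i => (x i).1) η hη) (BF.exp_cm hBern hξ2)
    have hB : PSDK (fun i j => Real.exp (-(ξ / 2) * finv (CT ((x i).2 - (x j).2)))) := by
      rw [psdk_iff]
      refine ⟨fun i j => ?_, fun c => hCTpd _ hξ2 N (fun i => (x i).2) c⟩
      rw [← hCTeven, neg_sub]
    have := hA.mul hB
    convert this using 3 with i j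
    rw [← Real.exp_add]
    congr 1
    simp only [Function.comp]
    ring
end

section
/- Let c ∈ (0,π] and let ν ≥ 2 be a real number. Then the truncated power (Askey) kernel (s₁,s₂) ↦ (1 − d_GC(s₁,s₂)/c)₊^ν is positive definite on 𝕊³. -/
open scoped RealInnerProductSpace

open Polynomial

noncomputable def askHz (n : ℕ) (q : ℂ[X]) (u v : ℂ[X]) : ℂ[X] :=
  ∑ l ∈ Finset.range (n + 1), C (q.coeff l) * u ^ l * v ^ (n - l)

lemma askHz_mul (n : ℕ) (q u v : ℂ[X]) (a b : ℂ) (hq : q.natDegree ≤ n) :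
    askHz (n + 1) ((C a * X + C b) * q) u v = (C a * u + C b * v) * askHz n q u v := by
  have h1 : askHz (n + 1) ((C a * X + C b) * q) u v =
      C a * (∑ l ∈ Finset.range (n + 2), C ((X * q).coeff l) * u ^ l * v ^ (n + 1 - l)) +
      C b * (∑ l ∈ Finset.range (n + 2), C (q.coeff l) * u ^ l * v ^ (n + 1 - l)) := by
    unfold askHz
    rw [Finset.mul_sum, Finset.mul_sum, ← Finset.sum_add_distrib]
    refine Finset.sum_congr rfl fun l _ => ?_
    rw [add_mul, mul_assoc (C a), coeff_add, coeff_C_mul, coeff_C_mul]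
    simp only [C_add, C_mul]
    ring
  rw [h1, Finset.sum_range_succ' , Finset.sum_range_succ (n := n + 1)]
  rw [coeff_eq_zero_of_natDegree_lt (show q.natDegree < n + 1 by omega)]
  simp only [coeff_X_mul, coeff_X_mul_zero, C_0, zero_mul, add_zero]
  unfold askHz
  have e1 : ∑ l ∈ Finset.range (n + 1), C (q.coeff l) * u ^ (l + 1) * v ^ (n + 1 - (l + 1)) =
      u * ∑ l ∈ Finset.range (n + 1), C (q.coeff l) * u ^ l * v ^ (n - l) := by
    rw [Finset.mul_sum]
    refine Finset.sum_congr rfl fun l _ => ?_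
    rw [Nat.add_sub_add_right]; ring
  have e2 : ∑ l ∈ Finset.range (n + 1), C (q.coeff l) * u ^ l * v ^ (n + 1 - l) =
      v * ∑ l ∈ Finset.range (n + 1), C (q.coeff l) * u ^ l * v ^ (n - l) := by
    rw [Finset.mul_sum]
    refine Finset.sum_congr rfl fun l hl => ?_
    rw [Nat.sub_add_comm (by simp at hl; omega)]; ring
  rw [e1, e2]; ring

lemma askHz_pow (a b c d : ℂ) (u v : ℂ[X]) (k m : ℕ) :
    ((C a * X + C c) ^ k * (C b * X + C d) ^ m).natDegree ≤ k + m ∧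
    askHz (k + m) ((C a * X + C c) ^ k * (C b * X + C d) ^ m) u v =
      (C a * u + C c * v) ^ k * (C b * u + C d * v) ^ m := by
  have hd : ((C a * X + C c) ^ k * (C b * X + C d) ^ m).natDegree ≤ k + m := by
    refine natDegree_mul_le.trans (add_le_add ?_ ?_)
    · exact (natDegree_pow_le_of_le k (natDegree_linear_le)).trans (by simp)
    · exact (natDegree_pow_le_of_le m (natDegree_linear_le)).trans (by simp)
  refine ⟨hd, ?_⟩
  clear hd
  induction k with
  | zero =>
    induction m with
    | zero => simp [askHz]
    | succ m ih =>
      have hd : ((C b * X + C d) ^ m).natDegree ≤ 0 + m :=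
        (natDegree_pow_le_of_le m (natDegree_linear_le)).trans (by simp)
      simp only [pow_zero, one_mul] at ih ⊢
      rw [pow_succ', ← add_assoc, askHz_mul _ _ _ _ _ _ hd, ih, pow_succ']
  | succ k ih =>
    have hd : ((C a * X + C c) ^ k * (C b * X + C d) ^ m).natDegree ≤ k + m := by
      refine natDegree_mul_le.trans (add_le_add ?_ ?_)
      · exact (natDegree_pow_le_of_le k (natDegree_linear_le)).trans (by simp)
      · exact (natDegree_pow_le_of_le m (natDegree_linear_le)).trans (by simp)
    rw [pow_succ', mul_assoc, show k + 1 + m = k + m + 1 by ring, askHz_mul _ _ _ _ _ _ hd, ih,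
      pow_succ', mul_assoc]

noncomputable def askP (n : ℕ) (g : Matrix (Fin 2) (Fin 2) ℂ) (k : ℕ) : ℂ[X] :=
  (C (g 0 0) * X + C (g 1 0)) ^ k * (C (g 0 1) * X + C (g 1 1)) ^ (n - k)

noncomputable def askS (n : ℕ) (g : Matrix (Fin 2) (Fin 2) ℂ) :
    Matrix (Fin (n + 1)) (Fin (n + 1)) ℂ :=
  Matrix.of fun j k => (askP n g k).coeff j

lemma askS_mul (n : ℕ) (g h : Matrix (Fin 2) (Fin 2) ℂ) :
    askS n (g * h) = askS n g * askS n h := by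
  ext j k
  have hk : (k : ℕ) + (n - k) = n := by omega
  have key := (askHz_pow (h 0 0) (h 0 1) (h 1 0) (h 1 1) (C (g 0 0) * X + C (g 1 0))
    (C (g 0 1) * X + C (g 1 1)) k (n - k)).2
  rw [hk] at key
  have e : askP n (g * h) k = askHz n (askP n h k) (C (g 0 0) * X + C (g 1 0))
    (C (g 0 1) * X + C (g 1 1)) := by
    unfold askP
    rw [key]
    simp only [Matrix.mul_apply, Fin.sum_univ_two, C_add, C_mul]
    ring
  simp only [askS, Matrix.of_apply, Matrix.mul_apply]
  rw [e, askHz, finsetSum_coeff, Finset.sum_range]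
  refine Finset.sum_congr rfl fun l _ => ?_
  rw [mul_assoc, coeff_C_mul, mul_comm]; rfl

lemma ask_biv (a b c d : ℂ) (n : ℕ) : ∀ j k : ℕ,
    (((C (C a * X + C c) * X + C (C b * X + C d) : ℂ[X][X]) ^ n).coeff k).coeff j =
    (((C (C a * X + C b) * X + C (C c * X + C d) : ℂ[X][X]) ^ n).coeff j).coeff k := by
  induction n with
  | zero => intro j k; simp only [pow_zero, coeff_one]; split_ifs <;> simp_all [coeff_one]
  | succ n ih =>
    intro j k
    rw [pow_succ', pow_succ']
    generalize (C (C a * X + C c) * X + C (C b * X + C d) : ℂ[X][X]) ^ n = A at ih ⊢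
    generalize (C (C a * X + C b) * X + C (C c * X + C d) : ℂ[X][X]) ^ n = B at ih ⊢
    simp only [add_mul, mul_assoc, coeff_add, coeff_C_mul]
    cases j <;> cases k <;> simp [coeff_X_mul, ih] <;> ring

lemma askP_choose (n : ℕ) (g : Matrix (Fin 2) (Fin 2) ℂ) (k : ℕ) :
    ((C (C (g 0 0) * X + C (g 1 0)) * X + C (C (g 0 1) * X + C (g 1 1)) : ℂ[X][X]) ^ n).coeff k
      = C (n.choose k : ℂ) * askP n g k := by
  rw [add_pow, finsetSum_coeff]
  have : ∀ m ∈ Finset.range (n+1), ((C (C (g 0 0) * X + C (g 1 0)) * X : ℂ[X][X]) ^ m *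
      C (C (g 0 1) * X + C (g 1 1)) ^ (n - m) * (n.choose m : ℂ[X][X])).coeff k
      = if k = m then C (n.choose k : ℂ) * askP n g k else 0 := by
    intro m _
    rw [mul_pow, ← C_pow, ← C_pow, show (n.choose m : ℂ[X][X]) = C (C (n.choose m : ℂ)) by simp,
      mul_assoc, mul_assoc, coeff_C_mul, ← C_mul, coeff_X_pow_mul', ]
    by_cases h : k = m
    · subst h
      simp only [le_refl, if_true, Nat.sub_self, coeff_C_zero, askP]; ring
    · rw [if_neg h]
      split_ifs with h2
      · rw [coeff_C_of_ne_zero (by omega), mul_zero]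
      · simp
  rw [Finset.sum_congr rfl this, Finset.sum_ite_eq]
  split_ifs with h
  · rfl
  · rw [Nat.choose_eq_zero_of_lt (by simpa using h)]; simp

lemma askS_transpose (n : ℕ) (g : Matrix (Fin 2) (Fin 2) ℂ) (j k : Fin (n + 1)) :
    (n.choose k : ℂ) * askS n g j k = (n.choose j : ℂ) * askS n g.transpose k j := by
  have h := ask_biv (g 0 0) (g 0 1) (g 1 0) (g 1 1) n j k
  have h2 := askP_choose n g.transpose j
  simp only [Matrix.transpose_apply] at h2
  rw [askP_choose, h2, coeff_C_mul, coeff_C_mul] at h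
  exact h

lemma askS_conj (n : ℕ) (g : Matrix (Fin 2) (Fin 2) ℂ) (j k : Fin (n + 1)) :
    askS n (g.map (starRingEnd ℂ)) j k = starRingEnd ℂ (askS n g j k) := by
  simp only [askS, Matrix.of_apply]
  rw [← coeff_map]
  congr 1
  simp [askP]

lemma askS_diag (n : ℕ) (l m : ℂ) :
    askS n !![l, 0; 0, m] = Matrix.diagonal fun k : Fin (n + 1) => l ^ (k:ℕ) * m ^ (n - k) := by
  ext j k
  have : askP n !![l, 0; 0, m] k = C (l ^ (k:ℕ) * m ^ (n - k)) * X ^ (k : ℕ) := by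
    simp [askP, mul_pow]; ring
  simp only [askS, Matrix.of_apply, this, coeff_C_mul, coeff_X_pow, Matrix.diagonal_apply]
  by_cases h : j = k
  · subst h; simp
  · have : (j : ℕ) ≠ k := fun h' => h (Fin.ext h')
    simp [h, this]

lemma askS_one (n : ℕ) : askS n 1 = 1 := by
  have : (1 : Matrix (Fin 2) (Fin 2) ℂ) = !![1, 0; 0, 1] := by
    ext i j; fin_cases i <;> fin_cases j <;> simp
  rw [this, askS_diag]; simp

lemma askS_trace_conj (n : ℕ) (g P d : Matrix (Fin 2) (Fin 2) ℂ) (hP : P.det ≠ 0)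
    (h : g * P = P * d) : (askS n g).trace = (askS n d).trace := by
  have hu : IsUnit P.det := isUnit_iff_ne_zero.mpr hP
  have : g = P * d * P⁻¹ := by
    rw [← h, mul_assoc, Matrix.mul_nonsing_inv _ hu, mul_one]
  rw [this, askS_mul, Matrix.trace_mul_comm, ← askS_mul, ← mul_assoc, Matrix.nonsing_inv_mul _ hu,
    one_mul]

/-- complete homogeneous sums -/
lemma ask_hsum (l m t : ℂ) (hs : l + m = 2 * t) (hp : l * m = 1) (n : ℕ) :
    ∑ k ∈ Finset.range (n + 1), l ^ k * m ^ (n - k) = (Chebyshev.U ℂ n).eval t := by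
  have step : ∀ n : ℕ, ∑ k ∈ Finset.range (n + 2), l ^ k * m ^ (n + 1 - k) =
      l ^ (n + 1) + m * ∑ k ∈ Finset.range (n + 1), l ^ k * m ^ (n - k) := by
    intro n
    rw [Finset.sum_range_succ, add_comm, Finset.mul_sum]
    congr 1
    · simp
    · refine Finset.sum_congr rfl fun k hk => ?_
      rw [Nat.sub_add_comm (by simp at hk; omega)]; ring
  induction n using Nat.strong_induction_on with
  | _ n ih =>
    match n with
    | 0 => simp
    | 1 => simp [Finset.sum_range_succ, ← hs]; ring
    | n + 2 =>
      have h1 := ih (n + 1) (by omega)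
      have h0 := ih n (by omega)
      push_cast at h1 ⊢
      rw [Chebyshev.U_add_two]
      simp only [eval_sub, eval_mul, eval_X, eval_ofNat]
      rw [← h1, ← h0, step (n + 1), step n, ← hs]
      linear_combination -(∑ k ∈ Finset.range (n + 1), l ^ k * m ^ (n - k)) * hp

lemma askS_trace (n : ℕ) (t : ℝ) (al be : ℂ) (ht : al + starRingEnd ℂ al = 2 * t)
    (h1 : al * starRingEnd ℂ al + be * starRingEnd ℂ be = 1) :
    (askS n !![al, - starRingEnd ℂ be; be, starRingEnd ℂ al]).trace
      = (Chebyshev.U ℂ n).eval (t : ℂ) := by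
  have fin : ∀ l m : ℂ, l + m = 2 * t → l * m = 1 → (askS n !![l, 0; 0, m]).trace
      = (Chebyshev.U ℂ n).eval (t : ℂ) := by
    intro l m hs hp
    rw [askS_diag, Matrix.trace_diagonal, ← ask_hsum l m t hs hp, Finset.sum_range]
  by_cases hb : be = 0
  · subst hb
    simp only [map_zero, neg_zero]
    exact fin _ _ ht (by simpa using h1)
  · obtain ⟨s, hs⟩ := IsAlgClosed.exists_eq_mul_self ((t : ℂ) ^ 2 - 1)
    rw [← fin (t + s) (t - s) (by ring) (by linear_combination hs)]
    have hs0 : s ≠ 0 := by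
      rintro rfl
      have ht' : al.re = t := by
        have := congrArg Complex.re ht
        simp at this
        linarith
      have h1' : al.re ^ 2 + al.im ^ 2 + (be.re ^ 2 + be.im ^ 2) = 1 := by
        have := congrArg Complex.re h1
        simp at this
        linarith
      have h2 : t ^ 2 - 1 = 0 := by
        have : ((t ^ 2 - 1 : ℝ) : ℂ) = 0 := by push_cast; rw [hs]; ring
        exact_mod_cast this
      apply hb
      apply Complex.ext
      · exact pow_eq_zero_iff two_ne_zero |>.1 (le_antisymm (by rw [ht'] at h1'; nlinarith [sq_nonneg be.re, sq_nonneg be.im, sq_nonneg al.im]) (sq_nonneg _))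
      · exact pow_eq_zero_iff two_ne_zero |>.1 (le_antisymm (by rw [ht'] at h1'; nlinarith [sq_nonneg be.re, sq_nonneg be.im, sq_nonneg al.im]) (sq_nonneg _))
    apply askS_trace_conj n _ !![t + s - starRingEnd ℂ al, t - s - starRingEnd ℂ al; be, be]
    · rw [Matrix.det_fin_two_of]
      have : (t + s - starRingEnd ℂ al) * be - (t - s - starRingEnd ℂ al) * be = 2 * s * be := by
        ring
      rw [this]
      exact mul_ne_zero (mul_ne_zero two_ne_zero hs0) hb
    · ext i j
      fin_cases i <;> fin_cases j <;> simp [Matrix.mul_apply, Fin.sum_univ_two]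
      · linear_combination (t + s) * ht - h1 + hs
      · linear_combination (t - s) * ht - h1 + hs
      · ring
      · ring

noncomputable def askM (x : EuclideanSpace ℝ (Fin 4)) : Matrix (Fin 2) (Fin 2) ℂ :=
  !![⟨x 0, x 1⟩, -⟨x 2, -x 3⟩; ⟨x 2, x 3⟩, ⟨x 0, -x 1⟩]

open scoped RealInnerProductSpace

lemma askM_mul (n : ℕ) (x y : EuclideanSpace ℝ (Fin 4)) (hx : ‖x‖ = 1) (hy : ‖y‖ = 1) :
    (askS n (askM x * ((askM y).map (starRingEnd ℂ)).transpose)).trace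
      = (Chebyshev.U ℂ n).eval ((⟪x, y⟫ : ℝ) : ℂ) := by
  have hx' : x 0 ^ 2 + x 1 ^ 2 + x 2 ^ 2 + x 3 ^ 2 = 1 := by
    have := EuclideanSpace.real_norm_sq_eq x
    rw [hx] at this
    simp [Fin.sum_univ_four] at this
    linarith
  have hy' : y 0 ^ 2 + y 1 ^ 2 + y 2 ^ 2 + y 3 ^ 2 = 1 := by
    have := EuclideanSpace.real_norm_sq_eq y
    rw [hy] at this
    simp [Fin.sum_univ_four] at this
    linarith
  have hin : ⟪x, y⟫ = x 0 * y 0 + x 1 * y 1 + x 2 * y 2 + x 3 * y 3 := by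
    simp [PiLp.inner_apply, Fin.sum_univ_four]; ring
  have key := askS_trace n ⟪x, y⟫
    (⟨x 0, x 1⟩ * ⟨y 0, -y 1⟩ + ⟨x 2, -x 3⟩ * ⟨y 2, y 3⟩)
    (⟨x 2, x 3⟩ * ⟨y 0, -y 1⟩ - ⟨x 0, -x 1⟩ * ⟨y 2, y 3⟩)
    (by rw [hin]; apply Complex.ext <;> simp <;> ring)
    (by
      apply Complex.ext
      · simp
        linear_combination (y 0 ^ 2 + y 1 ^ 2 + y 2 ^ 2 + y 3 ^ 2) * hx' + hy'
      · simp; ring)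
  rw [← key]
  congr 2
  ext i j
  fin_cases i <;> fin_cases j <;>
    simp [askM, Matrix.mul_apply, Fin.sum_univ_two] <;> apply Complex.ext <;> simp <;> ring

lemma ask_U_eq (n : ℕ) (x y : EuclideanSpace ℝ (Fin 4)) (hx : ‖x‖ = 1) (hy : ‖y‖ = 1) :
    (((Chebyshev.U ℝ n).eval ⟪x, y⟫ : ℝ) : ℂ) = ∑ j : Fin (n + 1), ∑ k : Fin (n + 1),
      (((n.choose k : ℝ) / (n.choose j) : ℝ) : ℂ) *
        (askS n (askM x) j k * starRingEnd ℂ (askS n (askM y) j k)) := by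
  have h := askM_mul n x y hx hy
  rw [askS_mul] at h
  have e : (((Chebyshev.U ℝ n).eval ⟪x, y⟫ : ℝ) : ℂ)
      = (Chebyshev.U ℂ n).eval ((⟪x, y⟫ : ℝ) : ℂ) := by
    exact Chebyshev.complex_ofReal_eval_U _ _
  rw [e, ← h]
  simp only [Matrix.trace, Matrix.diag_apply, Matrix.mul_apply]
  refine Finset.sum_congr rfl fun j _ => Finset.sum_congr rfl fun k _ => ?_
  have ht := askS_transpose n ((askM y).map (starRingEnd ℂ)) j k
  rw [askS_conj] at ht
  have hj : (n.choose j : ℂ) ≠ 0 := by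
    exact_mod_cast (Nat.choose_pos (by omega)).ne'
  have : askS n ((askM y).map (starRingEnd ℂ)).transpose k j
     = (n.choose k : ℂ) / (n.choose j) * starRingEnd ℂ (askS n (askM y) j k) := by
    field_simp
    rw [ht]; ring
  rw [this]; push_cast; ring

lemma ask_U_psd (n N : ℕ) (x : Fin N → EuclideanSpace ℝ (Fin 4)) (hx : ∀ i, ‖x i‖ = 1)
    (c : Fin N → ℝ) :
    0 ≤ ∑ i : Fin N, ∑ j : Fin N, c i * c j * (Chebyshev.U ℝ n).eval ⟪x i, x j⟫ := by
  have : ((∑ i : Fin N, ∑ j : Fin N, c i * c j * (Chebyshev.U ℝ n).eval ⟪x i, x j⟫ : ℝ) : ℂ)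
      = ((∑ a : Fin (n + 1), ∑ b : Fin (n + 1), ((n.choose b : ℝ) / (n.choose a)) *
        Complex.normSq (∑ i, c i * askS n (askM (x i)) a b) : ℝ) : ℂ) := by
    let F : Fin N → Fin N → Fin (n + 1) → Fin (n + 1) → ℂ := fun i j a b =>
      (((n.choose b : ℝ) / (n.choose a) : ℝ) : ℂ) * ((c i * askS n (askM (x i)) a b) *
        starRingEnd ℂ (c j * askS n (askM (x j)) a b))
    have hL : ((∑ i : Fin N, ∑ j : Fin N, c i * c j * (Chebyshev.U ℝ n).eval ⟪x i, x j⟫ : ℝ) : ℂ)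
        = ∑ i, ∑ j, ∑ a, ∑ b, F i j a b := by
      rw [Complex.ofReal_sum]
      refine Finset.sum_congr rfl fun i _ => ?_
      rw [Complex.ofReal_sum]
      refine Finset.sum_congr rfl fun j _ => ?_
      rw [Complex.ofReal_mul, ask_U_eq n _ _ (hx i) (hx j), Finset.mul_sum]
      refine Finset.sum_congr rfl fun a _ => ?_
      rw [Finset.mul_sum]
      refine Finset.sum_congr rfl fun b _ => ?_
      simp only [F]
      rw [map_mul, Complex.conj_ofReal, Complex.ofReal_mul]
      ring
    have hR : ∀ a b : Fin (n + 1), ((((n.choose b : ℝ) / (n.choose a)) *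
        Complex.normSq (∑ i, c i * askS n (askM (x i)) a b) : ℝ) : ℂ)
          = ∑ i, ∑ j, F i j a b := by
      intro a b
      rw [Complex.ofReal_mul, ← Complex.mul_conj, map_sum, Finset.sum_mul_sum, Finset.mul_sum]
      refine Finset.sum_congr rfl fun i _ => ?_
      rw [Finset.mul_sum]
    rw [hL, Complex.ofReal_sum]
    have hR2 : ∀ a : Fin (n + 1), ((∑ b : Fin (n + 1), ((n.choose b : ℝ) / (n.choose a)) *
        Complex.normSq (∑ i, c i * askS n (askM (x i)) a b) : ℝ) : ℂ)
          = ∑ b, ∑ i, ∑ j, F i j a b := by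
      intro a
      rw [Complex.ofReal_sum]
      exact Finset.sum_congr rfl fun b _ => hR a b
    rw [Finset.sum_congr rfl fun a _ => hR2 a]
    calc _ = ∑ i, ∑ a, ∑ j, ∑ b, F i j a b :=
          Finset.sum_congr rfl fun i _ => Finset.sum_comm
      _ = ∑ a, ∑ i, ∑ j, ∑ b, F i j a b := Finset.sum_comm
      _ = ∑ a, ∑ i, ∑ b, ∑ j, F i j a b :=
          Finset.sum_congr rfl fun a _ => Finset.sum_congr rfl fun i _ => Finset.sum_comm
      _ = ∑ a, ∑ b, ∑ i, ∑ j, F i j a b :=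
          Finset.sum_congr rfl fun a _ => Finset.sum_comm
  rw [Complex.ofReal_inj] at this
  rw [this]
  exact Finset.sum_nonneg fun a _ => Finset.sum_nonneg fun b _ =>
    mul_nonneg (by positivity) (Complex.normSq_nonneg _)

lemma ask_cusa (x : ℝ) (hx : 0 ≤ x) : 3 * Real.sin x ≤ x * (2 + Real.cos x) := by
  rcases le_or_gt 3 x with h | h
  · nlinarith [Real.sin_le_one x, Real.neg_one_le_cos x]
  · have hmono : MonotoneOn (fun y : ℝ => y * (2 + Real.cos y) - 3 * Real.sin y) (Set.Icc 0 3) := by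
      apply monotoneOn_of_deriv_nonneg (convex_Icc 0 3)
      · fun_prop
      · fun_prop
      · intro y hy
        rw [interior_Icc] at hy
        have hd : HasDerivAt (fun y : ℝ => y * (2 + Real.cos y) - 3 * Real.sin y)
            (1 * (2 + Real.cos y) + y * (- Real.sin y) - 3 * Real.cos y) y := by
          exact ((hasDerivAt_id y).mul ((Real.hasDerivAt_cos y).const_add 2)).sub
            ((Real.hasDerivAt_sin y).const_mul 3)
        rw [hd.deriv]
        have hy2 : 0 < y / 2 := by linarith [hy.1]
        have hpi : y / 2 < Real.pi / 2 := by linarith [hy.2, Real.pi_gt_three]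
        have hc : 0 < Real.cos (y / 2) := Real.cos_pos_of_mem_Ioo ⟨by linarith, hpi⟩
        have hs : 0 < Real.sin (y / 2) := Real.sin_pos_of_pos_of_lt_pi hy2 (by linarith)
        have ht := Real.lt_tan hy2 hpi
        rw [Real.tan_eq_sin_div_cos, lt_div_iff₀ hc] at ht
        have e1 : Real.cos y = 1 - 2 * Real.sin (y / 2) ^ 2 := by
          have := Real.cos_two_mul (y / 2)
          rw [show 2 * (y / 2) = y by ring] at this
          nlinarith [Real.sin_sq_add_cos_sq (y / 2)]
        have e2 : Real.sin y = 2 * Real.sin (y / 2) * Real.cos (y / 2) := by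
          rw [← Real.sin_two_mul]; congr 1; ring
        rw [e1, e2]
        nlinarith [mul_pos hs (sub_pos.2 ht)]
    have := hmono (Set.mem_Icc.2 ⟨le_refl 0, by norm_num⟩) (Set.mem_Icc.2 ⟨hx, h.le⟩) hx
    simp at this
    linarith

lemma ask_anti : AntitoneOn (fun x : ℝ => (x - Real.sin x) / x ^ 3) (Set.Ioi 0) := by
  have hd : ∀ x : ℝ, 0 < x → HasDerivAt (fun x : ℝ => (x - Real.sin x) / x ^ 3)
      (((1 - Real.cos x) * x ^ 3 - (x - Real.sin x) * (3 * x ^ 2)) / (x ^ 3) ^ 2) x := by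
    intro x hx
    have := ((hasDerivAt_id x).sub (Real.hasDerivAt_sin x)).div (hasDerivAt_pow 3 x)
      (by positivity)
    exact this.congr_deriv (by simp)
  apply antitoneOn_of_deriv_nonpos (convex_Ioi 0)
  · intro x hx
    exact (hd x hx).continuousAt.continuousWithinAt
  · intro x hx
    rw [interior_Ioi] at hx
    exact (hd x hx).differentiableAt.differentiableWithinAt
  · intro x hx
    rw [interior_Ioi] at hx
    rw [(hd x hx).deriv]
    apply div_nonpos_of_nonpos_of_nonneg _ (by positivity)
    have h := ask_cusa x (le_of_lt hx)
    have hx2 : 0 < x ^ 2 := pow_pos hx 2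
    nlinarith

/-- the (unnormalised) cosine coefficients -/
noncomputable def askA (c : ℝ) (n : ℕ) : ℝ := ∫ x in (0:ℝ)..c, Real.cos (n * x) * (1 - x / c) ^ 2

lemma askA_eq (c : ℝ) (hc : 0 < c) (n : ℕ) (hn : n ≠ 0) :
    askA c n = 2 * c * (((n * c) - Real.sin (n * c)) / (n * c) ^ 3) := by
  have hn' : (n : ℝ) ≠ 0 := by exact_mod_cast hn
  unfold askA
  rw [intervalIntegral.integral_eq_sub_of_hasDerivAt (f := fun x => (1 - x / c) ^ 2 *
    Real.sin (n * x) / n - (2 / c) * ((1 - x / c) * Real.cos (n * x)) / n ^ 2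
     - (2 / c ^ 2) * Real.sin (n * x) / n ^ 3)]
  · simp [hc.ne']
    field_simp
    ring
  · intro x _
    have h1 : HasDerivAt (fun x : ℝ => 1 - x / c) (- (1 / c)) x :=
      ((hasDerivAt_id x).div_const c).const_sub 1
    have h2 : HasDerivAt (fun x : ℝ => (n : ℝ) * x) (n * 1) x := (hasDerivAt_id x).const_mul _
    have h3 := (((h1.pow 2).mul h2.sin).div_const n).sub
      (((h1.mul h2.cos).const_mul (2 / c)).div_const ((n : ℝ) ^ 2)) |>.sub
      ((h2.sin.const_mul (2 / c ^ 2)).div_const ((n : ℝ) ^ 3))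
    refine h3.congr_deriv ?_
    simp
    field_simp
    ring
  · apply Continuous.intervalIntegrable
    fun_prop

lemma askA_le (c : ℝ) (hc : 0 < c) (n : ℕ) : askA c (n + 2) ≤ askA c n := by
  rcases Nat.eq_zero_or_pos n with rfl | hn
  · unfold askA
    apply intervalIntegral.integral_mono_on hc.le
    · apply Continuous.intervalIntegrable; fun_prop
    · apply Continuous.intervalIntegrable; fun_prop
    · intro x _
      apply mul_le_mul_of_nonneg_right _ (sq_nonneg _)
      simpa using Real.cos_le_one _
  · rw [askA_eq c hc _ (by omega), askA_eq c hc n (by omega)]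
    have hn' : (0:ℝ) < n := by exact_mod_cast hn
    apply mul_le_mul_of_nonneg_left _ (by positivity)
    apply ask_anti (Set.mem_Ioi.2 (by positivity)) (Set.mem_Ioi.2 (by positivity))
    push_cast
    nlinarith

lemma askA_nonneg (c : ℝ) (hc : 0 < c) (n : ℕ) : 0 ≤ askA c n := by
  rcases Nat.eq_zero_or_pos n with rfl | hn
  · unfold askA
    apply intervalIntegral.integral_nonneg hc.le
    intro x _
    simp; positivity
  · rw [askA_eq c hc n (by omega)]
    have hn' : (0:ℝ) < n := by exact_mod_cast hn
    have := Real.sin_le (show 0 ≤ n * c by positivity)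
    have h2 : 0 ≤ n * c - Real.sin (n * c) := by linarith
    positivity

lemma askA_bound (c : ℝ) (hc : 0 < c) (n : ℕ) (hn : n ≠ 0) : askA c n ≤ 4 / c * (1 / (n:ℝ) ^ 2) := by
  rw [askA_eq c hc n hn]
  have hn' : (0:ℝ) < n := by exact_mod_cast Nat.pos_of_ne_zero hn
  have h2 : n * c - Real.sin (n * c) ≤ 2 * (n * c) := by
    have := Real.sin_le (show 0 ≤ n * c by positivity)
    have := (abs_le.1 (Real.abs_sin_le_abs (x := n * c))).1
    rw [abs_of_nonneg (by positivity)] at this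
    linarith
  calc _ ≤ 2 * c * (2 * (n * c) / (n * c) ^ 3) := by gcongr
    _ = _ := by field_simp; norm_num

lemma ask_telescope (A : ℕ → ℝ) (t : ℝ) (N : ℕ) :
    ∑ n ∈ Finset.range (N + 2), 2 * A n * (Chebyshev.T ℝ n).eval t - A 0 =
      ∑ n ∈ Finset.range N, (A n - A (n + 2)) * (Chebyshev.U ℝ n).eval t
        + A N * (Chebyshev.U ℝ N).eval t
        + A (N + 1) * (Chebyshev.U ℝ (N + 1 : ℕ)).eval t := by
  induction N with
  | zero => simp [Finset.sum_range_succ]; ring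
  | succ N ih =>
    rw [Finset.sum_range_succ, Finset.sum_range_succ _ N]
    have h := congrArg (eval t) (Chebyshev.two_mul_T_eq_U_sub_U ℝ (N : ℤ))
    simp only [eval_mul, eval_sub, eval_ofNat] at h
    push_cast at ih h ⊢
    rw [show (N : ℤ) + 1 + 1 = N + 2 by ring]
    linear_combination ih + A (N + 2) * h

open MeasureTheory in
lemma ask_coeff (c : ℝ) (hc : 0 < c) (hcpi : c ≤ Real.pi) (n : ℕ) (m : ℤ) (hm : |m| = n)
    [Fact (0 < 2 * Real.pi)] :
    fourierCoeff (fun x : AddCircle (2 * Real.pi) => (((max (1 - ‖x‖ / c) 0) ^ 2 : ℝ) : ℂ)) m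
      = ((askA c n / Real.pi : ℝ) : ℂ) := by
  have hpi := Real.pi_pos
  rw [fourierCoeff_eq_intervalIntegral _ _ (-Real.pi), show -Real.pi + 2 * Real.pi = Real.pi by ring]
  have e : ∀ x ∈ Set.uIcc (-Real.pi) Real.pi, (fourier (-m) (x : AddCircle (2 * Real.pi)) •
      (((max (1 - ‖(x : AddCircle (2 * Real.pi))‖ / c) 0) ^ 2 : ℝ) : ℂ))
      = Complex.exp (-(m * x * Complex.I)) * (((max (1 - |x| / c) 0) ^ 2 : ℝ) : ℂ) := by
    intro x hx
    rw [Set.uIcc_of_le (by linarith)] at hx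
    rw [(AddCircle.norm_coe_eq_abs_iff _ (by positivity)).2
      (by rw [abs_of_pos (by positivity : 0 < 2 * Real.pi)]; rw [abs_le]; constructor <;> linarith [hx.1, hx.2]),
      fourier_coe_apply, smul_eq_mul]
    congr 2
    push_cast
    have : (Real.pi : ℂ) ≠ 0 := by exact_mod_cast hpi.ne'
    field_simp
  rw [intervalIntegral.integral_congr e]
  set G : ℝ → ℂ := fun x => Complex.exp (-(m * x * Complex.I)) * (((max (1 - |x| / c) 0) ^ 2 : ℝ) : ℂ)
  have hG : Continuous G := by fun_prop
  have hsplit : ∫ x in (-Real.pi)..Real.pi, G x = ∫ x in (0:ℝ)..Real.pi, (G (-x) + G x) := by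
    rw [intervalIntegral.integral_add (by apply Continuous.intervalIntegrable; fun_prop)
      (hG.intervalIntegrable _ _), intervalIntegral.integral_comp_neg, neg_zero,
      intervalIntegral.integral_add_adjacent_intervals (hG.intervalIntegrable _ _)
      (hG.intervalIntegrable _ _)]
  have hsum : ∀ x ∈ Set.uIcc 0 Real.pi, G (-x) + G x =
      ((2 * (Real.cos (n * x) * (max (1 - x / c) 0) ^ 2) : ℝ) : ℂ) := by
    intro x hx
    rw [Set.uIcc_of_le hpi.le] at hx
    have hcos : Real.cos (n * x) = Real.cos (m * x) := by
      have : (n : ℝ) = |(m : ℝ)| := by exact_mod_cast hm.symm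
      rw [this]
      rcases abs_choice (m : ℝ) with h | h <;> rw [h]
      rw [neg_mul, Real.cos_neg]
    rw [hcos]
    simp only [G, abs_neg, abs_of_nonneg hx.1]
    push_cast
    have := Complex.two_cos (m * x)
    rw [← mul_assoc, this]
    rw [show -((m:ℂ) * -x * Complex.I) = m * x * Complex.I by ring,
      show -((m:ℂ) * x * Complex.I) = -(m * x) * Complex.I by ring]
    ring
  rw [hsplit, intervalIntegral.integral_congr hsum, intervalIntegral.integral_ofReal,
    intervalIntegral.integral_const_mul]
  have hA : ∫ x in (0:ℝ)..Real.pi, Real.cos (n * x) * (max (1 - x / c) 0) ^ 2 = askA c n := by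
    have hcont : Continuous fun x : ℝ => Real.cos (n * x) * (max (1 - x / c) 0) ^ 2 := by fun_prop
    rw [← intervalIntegral.integral_add_adjacent_intervals (hcont.intervalIntegrable 0 c)
      (hcont.intervalIntegrable c Real.pi)]
    have h2 : ∫ x in c..Real.pi, Real.cos (n * x) * (max (1 - x / c) 0) ^ 2 = 0 := by
      rw [intervalIntegral.integral_congr (g := fun _ => (0:ℝ))]
      · simp
      · intro x hx
        rw [Set.uIcc_of_le hcpi] at hx
        have : 1 ≤ x / c := (one_le_div hc).2 hx.1
        simp only
        rw [max_eq_right (by linarith)]; simp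
    rw [h2, add_zero, askA]
    apply intervalIntegral.integral_congr
    intro x hx
    rw [Set.uIcc_of_le hc.le] at hx
    have : x / c ≤ 1 := (div_le_one hc).2 hx.2
    simp only
    rw [max_eq_left (by linarith)]
  rw [hA, Complex.real_smul, ← Complex.ofReal_mul]
  congr 1
  field_simp

lemma ask_fourier (c : ℝ) (hc : 0 < c) (hcpi : c ≤ Real.pi) (θ : ℝ) (h0 : 0 ≤ θ)
    (h1 : θ ≤ Real.pi) :
    Filter.Tendsto (fun N : ℕ => ∑ n ∈ Finset.range N, 2 * (askA c n / Real.pi) * Real.cos (n * θ)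
      - askA c 0 / Real.pi) Filter.atTop (nhds ((max (1 - θ / c) 0) ^ 2)) := by
  have hpi := Real.pi_pos
  have : Fact (0 < 2 * Real.pi) := ⟨by positivity⟩
  let f : C(AddCircle (2 * Real.pi), ℂ) :=
    ⟨fun x => (((max (1 - ‖x‖ / c) 0) ^ 2 : ℝ) : ℂ), by fun_prop⟩
  have hcoef : ∀ m : ℤ, fourierCoeff f m = ((askA c m.natAbs / Real.pi : ℝ) : ℂ) := fun m =>
    ask_coeff c hc hcpi m.natAbs m (by simp)
  have hsN : Summable fun n : ℕ => askA c n / Real.pi := by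
    apply Summable.div_const
    rw [← summable_nat_add_iff 1]
    have hb : Summable fun n : ℕ => 4 / c * (1 / ((n + 1 : ℕ):ℝ) ^ 2) :=
      ((summable_nat_add_iff 1).2 (Real.summable_one_div_nat_pow.2 one_lt_two)).mul_left _
    exact Summable.of_nonneg_of_le (fun n => askA_nonneg c hc _)
      (fun n => askA_bound c hc _ (by omega)) hb
  have hsC : Summable fun n : ℕ => ((askA c n / Real.pi : ℝ) : ℂ) := by
    exact_mod_cast hsN
  have hs : Summable (fourierCoeff f) := by
    refine Summable.of_nat_of_neg ?_ ?_
    · simpa [hcoef] using hsC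
    · simpa [hcoef] using hsC
  have key := (has_pointwise_sum_fourier_series_of_summable hs (θ : AddCircle (2 * Real.pi))).nat_add_neg
  have hfθ : f (θ : AddCircle (2 * Real.pi)) = (((max (1 - θ / c) 0) ^ 2 : ℝ) : ℂ) := by
    simp only [f, ContinuousMap.coe_mk]
    rw [(AddCircle.norm_coe_eq_abs_iff _ (by positivity)).2
      (by rw [abs_of_pos (by positivity : 0 < 2 * Real.pi)]; rw [abs_le]; constructor <;> linarith),
      abs_of_nonneg h0]
  have hterm : ∀ n : ℕ, fourierCoeff f (n : ℤ) • fourier (n : ℤ) (θ : AddCircle (2 * Real.pi)) +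
      fourierCoeff f (-(n : ℤ)) • fourier (-(n : ℤ)) (θ : AddCircle (2 * Real.pi)) =
      ((2 * (askA c n / Real.pi) * Real.cos (n * θ) : ℝ) : ℂ) := by
    intro n
    rw [hcoef, hcoef, fourier_coe_apply, fourier_coe_apply]
    simp only [Int.natAbs_neg, Int.natAbs_natCast, smul_eq_mul]
    have hp : (Real.pi : ℂ) ≠ 0 := by exact_mod_cast hpi.ne'
    have := Complex.two_cos (n * θ)
    have e1 : 2 * (Real.pi : ℂ) * Complex.I * ((n : ℤ) : ℂ) * θ / ((2 * Real.pi : ℝ) : ℂ)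
        = n * θ * Complex.I := by push_cast; field_simp
    have e2 : 2 * (Real.pi : ℂ) * Complex.I * ((-(n : ℤ) : ℤ) : ℂ) * θ / ((2 * Real.pi : ℝ) : ℂ)
        = -(n * θ) * Complex.I := by push_cast; field_simp
    rw [e1, e2, ← mul_add, ← this]
    push_cast
    ring
  simp only [hterm] at key
  rw [hfθ, hcoef] at key
  simp only [fourier_zero, Int.natAbs_zero, smul_eq_mul, mul_one] at key
  rw [← Complex.ofReal_add, Complex.hasSum_ofReal] at key
  have := key.tendsto_sum_nat.sub_const (askA c 0 / Real.pi)
  simpa using this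

open scoped RealInnerProductSpace

lemma ask_two_psd (c : ℝ) (hc : 0 < c) (hcpi : c ≤ Real.pi) (N : ℕ)
    (x : Fin N → EuclideanSpace ℝ (Fin 4)) (hx : ∀ i, ‖x i‖ = 1) (a : Fin N → ℝ) :
    0 ≤ ∑ i : Fin N, ∑ j : Fin N, a i * a j *
      (max (1 - Real.arccos ⟪x i, x j⟫ / c) 0) ^ 2 := by
  have hpi := Real.pi_pos
  have hlim : Filter.Tendsto (fun M : ℕ => ∑ i : Fin N, ∑ j : Fin N, a i * a j *
      (∑ n ∈ Finset.range M, 2 * (askA c n / Real.pi) * Real.cos (n * Real.arccos ⟪x i, x j⟫)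
      - askA c 0 / Real.pi)) Filter.atTop (nhds (∑ i : Fin N, ∑ j : Fin N, a i * a j *
      (max (1 - Real.arccos ⟪x i, x j⟫ / c) 0) ^ 2)) := by
    refine tendsto_finsetSum _ fun i _ => tendsto_finsetSum _ fun j _ => ?_
    exact (ask_fourier c hc hcpi _ (Real.arccos_nonneg _) (Real.arccos_le_pi _)).const_mul _
  refine ge_of_tendsto ((Filter.tendsto_add_atTop_iff_nat 2).2 hlim)
    (Filter.Eventually.of_forall fun M => ?_)
  have hB : ∀ n, 0 ≤ askA c n / Real.pi := fun n => div_nonneg (askA_nonneg c hc n) hpi.le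
  have hBd : ∀ n, 0 ≤ askA c n / Real.pi - askA c (n + 2) / Real.pi := fun n =>
    sub_nonneg.2 (div_le_div_of_nonneg_right (askA_le c hc n) hpi.le)
  have hterm : ∀ i j : Fin N, ∑ n ∈ Finset.range (M + 2), 2 * (askA c n / Real.pi) *
      Real.cos (n * Real.arccos ⟪x i, x j⟫) - askA c 0 / Real.pi =
      ∑ n ∈ Finset.range M, (askA c n / Real.pi - askA c (n + 2) / Real.pi) *
          (Chebyshev.U ℝ n).eval ⟪x i, x j⟫
        + askA c M / Real.pi * (Chebyshev.U ℝ M).eval ⟪x i, x j⟫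
        + askA c (M + 1) / Real.pi * (Chebyshev.U ℝ (M + 1 : ℕ)).eval ⟪x i, x j⟫ := by
    intro i j
    rw [← ask_telescope (fun n => askA c n / Real.pi)]
    congr 1
    refine Finset.sum_congr rfl fun n _ => ?_
    have hle : |⟪x i, x j⟫| ≤ 1 := by
      simpa [hx] using abs_real_inner_le_norm (x i) (x j)
    have hT := Chebyshev.T_real_cos (Real.arccos ⟪x i, x j⟫) n
    rw [Real.cos_arccos (abs_le.1 hle).1 (abs_le.1 hle).2] at hT
    rw [hT]
    simp
  have hU : ∀ (b : ℝ) (n : ℕ), 0 ≤ b → 0 ≤ ∑ i : Fin N, ∑ j : Fin N, a i * a j *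
      (b * (Chebyshev.U ℝ n).eval ⟪x i, x j⟫) := by
    intro b n hb
    have := mul_nonneg hb (ask_U_psd n N x hx a)
    rw [Finset.mul_sum] at this
    refine this.trans_eq (Finset.sum_congr rfl fun i _ => ?_)
    rw [Finset.mul_sum]
    exact Finset.sum_congr rfl fun j _ => by ring
  have hexp : ∑ i : Fin N, ∑ j : Fin N, a i * a j *
      (∑ n ∈ Finset.range (M + 2), 2 * (askA c n / Real.pi) *
        Real.cos (n * Real.arccos ⟪x i, x j⟫) - askA c 0 / Real.pi) =
      ∑ n ∈ Finset.range M, (∑ i : Fin N, ∑ j : Fin N, a i * a j *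
        ((askA c n / Real.pi - askA c (n + 2) / Real.pi) * (Chebyshev.U ℝ n).eval ⟪x i, x j⟫))
      + ∑ i : Fin N, ∑ j : Fin N, a i * a j *
        (askA c M / Real.pi * (Chebyshev.U ℝ M).eval ⟪x i, x j⟫)
      + ∑ i : Fin N, ∑ j : Fin N, a i * a j *
        (askA c (M + 1) / Real.pi * (Chebyshev.U ℝ (M + 1 : ℕ)).eval ⟪x i, x j⟫) := by
    simp_rw [hterm, mul_add, Finset.sum_add_distrib]
    congr 2
    simp_rw [Finset.mul_sum]
    have : ∀ F : Fin N → Fin N → ℕ → ℝ, ∑ i, ∑ j, ∑ n ∈ Finset.range M, F i j n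
        = ∑ n ∈ Finset.range M, ∑ i, ∑ j, F i j n := by
      intro F
      calc _ = ∑ i, ∑ n ∈ Finset.range M, ∑ j, F i j n :=
            Finset.sum_congr rfl fun i _ => Finset.sum_comm
        _ = _ := Finset.sum_comm
    exact this _
  rw [hexp]
  exact add_nonneg (add_nonneg (Finset.sum_nonneg fun n _ => hU _ n (hBd n)) (hU _ _ (hB _)))
    (hU _ _ (hB _))

open MeasureTheory in
lemma ask_intble (c ν θ : ℝ) (hν : 2 < ν) (p q : ℝ) :
    IntervalIntegrable (fun u : ℝ => (max (u - θ) 0) ^ 2 * (c - u) ^ (ν - 3)) volume p q := by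
  have h : IntervalIntegrable (fun u : ℝ => (c - u) ^ (ν - 3)) volume p q := by
    have := (intervalIntegral.intervalIntegrable_rpow' (a := c - p) (b := c - q)
      (show -1 < ν - 3 by linarith)).comp_sub_left c
    simpa using this
  exact h.continuousOn_mul (by fun_prop)

lemma ask_beta (c ν θ : ℝ) (hc : 0 < c) (hν : 2 < ν) (hθ : 0 ≤ θ) :
    ∫ u in (0:ℝ)..c, (max (u - θ) 0) ^ 2 * (c - u) ^ (ν - 3) =
      (∫ s in (0:ℝ)..1, (max (s - 0) 0) ^ 2 * (1 - s) ^ (ν - 3)) * c ^ ν *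
        (max (1 - θ / c) 0) ^ ν := by
  rcases le_or_gt c θ with h | h
  · have h1 : 1 ≤ θ / c := (one_le_div hc).2 h
    rw [max_eq_right (by linarith : 1 - θ / c ≤ 0), Real.zero_rpow (by linarith), mul_zero]
    rw [intervalIntegral.integral_congr (g := fun _ => (0:ℝ))]
    · simp
    · intro u hu
      rw [Set.uIcc_of_le hc.le] at hu
      simp only
      rw [max_eq_right (by linarith [hu.2])]; simp
  · have h1 : θ / c < 1 := (div_lt_one hc).2 h
    rw [max_eq_left (by linarith : 0 ≤ 1 - θ / c), mul_assoc,
      ← Real.mul_rpow hc.le (by linarith), show c * (1 - θ / c) = c - θ by field_simp]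
    rw [← intervalIntegral.integral_add_adjacent_intervals (ask_intble c ν θ hν 0 θ)
      (ask_intble c ν θ hν θ c)]
    have hz : ∫ u in (0:ℝ)..θ, (max (u - θ) 0) ^ 2 * (c - u) ^ (ν - 3) = 0 := by
      rw [intervalIntegral.integral_congr (g := fun _ => (0:ℝ))]
      · simp
      · intro u hu
        rw [Set.uIcc_of_le hθ] at hu
        simp only
        rw [max_eq_right (by linarith [hu.2])]; simp
    rw [hz, zero_add]
    have hs := intervalIntegral.mul_integral_comp_mul_add
      (f := fun u : ℝ => (max (u - θ) 0) ^ 2 * (c - u) ^ (ν - 3)) (a := 0) (b := 1) (c - θ) θ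
    rw [show (c - θ) * 0 + θ = θ by ring, show (c - θ) * 1 + θ = c by ring] at hs
    rw [← hs]
    have hd : 0 < c - θ := by linarith
    have hp : (c - θ) ^ ν = (c - θ) * ((c - θ) ^ 2 * (c - θ) ^ (ν - 3)) := by
      rw [← mul_assoc, ← pow_succ', show ν = ((3 : ℕ) : ℝ) + (ν - 3) by push_cast; ring,
        Real.rpow_add hd, Real.rpow_natCast]
      congr 2
      push_cast; ring
    rw [hp, mul_comm (∫ s in (0:ℝ)..1, _), mul_assoc (c - θ)]
    congr 1
    rw [← intervalIntegral.integral_const_mul]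
    apply intervalIntegral.integral_congr
    intro s hs
    rw [Set.uIcc_of_le zero_le_one] at hs
    simp only
    rw [show (c - θ) * s + θ - θ = (c - θ) * s by ring,
      show c - ((c - θ) * s + θ) = (c - θ) * (1 - s) by ring,
      Real.mul_rpow hd.le (by linarith [hs.2]), max_eq_left (mul_nonneg hd.le hs.1), sub_zero,
      max_eq_left hs.1]
    ring

open MeasureTheory in
theorem askey_posdef_sphere3 (c ν : ℝ) (hc0 : 0 < c) (hcπ : c ≤ Real.pi) (hν : 2 ≤ ν) :
    IsPosDefKernel (fun s₁ s₂ : Metric.sphere (0 : EuclideanSpace ℝ (Fin 4)) 1 =>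
      max (1 - gcDist (s₁ : EuclideanSpace ℝ (Fin 4)) (s₂ : EuclideanSpace ℝ (Fin 4)) / c) 0 ^ ν) := by
  intro N x a
  have hx : ∀ i, ‖(x i : EuclideanSpace ℝ (Fin 4))‖ = 1 := fun i => by simp
  simp only [gcDist]
  rcases hν.eq_or_lt with rfl | hν
  · have := ask_two_psd c hc0 hcπ N (fun i => (x i : EuclideanSpace ℝ (Fin 4))) hx a
    simpa [Real.rpow_two] using this
  · set B : ℝ := ∫ s in (0:ℝ)..1, (max (s - 0) 0) ^ 2 * (1 - s) ^ (ν - 3) with hB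
    have hBpos : 0 < B := by
      apply intervalIntegral.intervalIntegral_pos_of_pos_on (ask_intble 1 ν 0 hν 0 1) _ one_pos
      intro s hs
      have h1 : 0 < max (s - 0) 0 := lt_max_of_lt_left (by linarith [hs.1])
      have h2 : 0 < 1 - s := by linarith [hs.2]
      positivity
    have hC : 0 < B * c ^ ν := by positivity
    refine nonneg_of_mul_nonneg_right (a := B * c ^ ν) ?_ hC
    have e : B * c ^ ν * ∑ i : Fin N, ∑ j : Fin N, a i * a j *
        max (1 - Real.arccos ⟪(x i : EuclideanSpace ℝ (Fin 4)), (x j : EuclideanSpace ℝ (Fin 4))⟫ / c) 0 ^ ν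
        = ∫ u in (0:ℝ)..c, ∑ i : Fin N, ∑ j : Fin N, a i * a j *
          ((max (u - Real.arccos ⟪(x i : EuclideanSpace ℝ (Fin 4)), (x j : EuclideanSpace ℝ (Fin 4))⟫) 0) ^ 2
            * (c - u) ^ (ν - 3)) := by
      have hI : ∀ i j : Fin N, IntervalIntegrable (fun u : ℝ => a i * a j *
          ((max (u - Real.arccos ⟪(x i : EuclideanSpace ℝ (Fin 4)), (x j : EuclideanSpace ℝ (Fin 4))⟫) 0) ^ 2
            * (c - u) ^ (ν - 3))) volume 0 c := fun i j => (ask_intble c ν _ hν 0 c).const_mul _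
      rw [intervalIntegral.integral_finsetSum
        (fun i _ => by
          simpa only [Finset.sum_fn] using IntervalIntegrable.sum Finset.univ fun j _ => hI i j),
        Finset.mul_sum]
      refine Finset.sum_congr rfl fun i _ => ?_
      rw [intervalIntegral.integral_finsetSum (fun j _ => hI i j), Finset.mul_sum]
      refine Finset.sum_congr rfl fun j _ => ?_
      rw [intervalIntegral.integral_const_mul, ask_beta c ν _ hc0 hν (Real.arccos_nonneg _)]
      ring
    rw [e]
    apply intervalIntegral.integral_nonneg hc0.le
    intro u hu
    rcases hu.1.eq_or_lt with rfl | hu0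
    · refine le_of_eq (Eq.symm ?_)
      refine Finset.sum_eq_zero fun i _ => Finset.sum_eq_zero fun j _ => ?_
      rw [max_eq_right (by rw [zero_sub]; exact neg_nonpos.2 (Real.arccos_nonneg _))]
      simp
    · have h := ask_two_psd u hu0 (hu.2.trans hcπ) N (fun i => (x i : EuclideanSpace ℝ (Fin 4))) hx a
      have hw : 0 ≤ u ^ 2 * (c - u) ^ (ν - 3) :=
        mul_nonneg (sq_nonneg _) (Real.rpow_nonneg (by linarith [hu.2]) _)
      refine (mul_nonneg hw h).trans_eq ?_
      rw [Finset.mul_sum]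
      refine Finset.sum_congr rfl fun i _ => ?_
      rw [Finset.mul_sum]
      refine Finset.sum_congr rfl fun j _ => ?_
      generalize Real.arccos ⟪(x i : EuclideanSpace ℝ (Fin 4)), (x j : EuclideanSpace ℝ (Fin 4))⟫ = t
      have : max (u - t) 0 = u * max (1 - t / u) 0 := by
        rw [mul_max_of_nonneg _ _ hu0.le, mul_zero]
        congr 1
        field_simp
      rw [this]; ring
end
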